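/- arXiv:2001.00382 — 2 statements merged into one kernel-verified Lean document; each statement's English description precedes it below -/
import Mathlib

section
/- Let Φ be an integral domain and let L = L_Φ⟨x_1,…,x_n⟩ be the free Lie algebra over Φ on free generators x_1,…,x_n. Two elements f_1, f_2 of L are Lie-dependent (i.e., they do not freely generate a free Lie subalgebra of rank 2) if and only if f_1 and f_2 are linearly dependent over Φ. -/
section Lyndon

variable {α : Type*} [LinearOrder α]

theorem List.append_lt_append_of_not_prefix {a b : List α} (h : a < b) (hp : ¬ a <+: b)
    (c d : List α) : a ++ c < b ++ d := by
  induction a generalizing b with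
  | nil => simp at hp
  | cons x a ih =>
    cases b with
    | nil => simp at h
    | cons y b =>
      rw [List.cons_append, List.cons_append, List.cons_lt_cons_iff]
      rcases List.cons_lt_cons_iff.mp h with hxy | ⟨rfl, hab⟩
      · exact Or.inl hxy
      · exact Or.inr ⟨rfl, ih hab fun hpre => hp ((List.prefix_cons_inj x).mpr hpre)⟩

theorem List.append_lt_append_of_lt_of_length_le {a b : List α} (h : a < b)
    (hl : b.length ≤ a.length) (c d : List α) : a ++ c < b ++ d :=
  List.append_lt_append_of_not_prefix h
    (fun hp => h.ne (hp.eq_of_length (le_antisymm hp.length_le hl))) c d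

theorem List.lt_append_of_ne_nil {a b : List α} (hb : b ≠ []) : a < a ++ b := by
  obtain ⟨x, b, rfl⟩ := List.exists_cons_of_ne_nil hb
  simpa using List.append_left_lt (l₁ := a) (List.nil_lt_cons x b)

/-- A Lyndon word: a nonempty word strictly smaller than all its proper nonempty suffixes. -/
def IsLyndon (w : List α) : Prop :=
  w ≠ [] ∧ ∀ a b, a ≠ [] → b ≠ [] → w = a ++ b → w < b

theorem isLyndon_singleton (x : α) : IsLyndon [x] := by
  refine ⟨by simp, fun a b ha hb h => ?_⟩
  have := congrArg List.length h
  have h1 := List.length_pos_of_ne_nil ha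
  have h2 := List.length_pos_of_ne_nil hb
  simp at this
  omega

theorem IsLyndon.append_lt {u v : List α} (hu : IsLyndon u) (hv : IsLyndon v) (h : u < v) :
    u ++ v < v := by
  by_cases hp : u <+: v
  · obtain ⟨r, rfl⟩ := hp
    have hr : r ≠ [] := by rintro rfl; simp at h
    exact List.append_left_lt (hv.2 u r hu.1 hr rfl)
  · simpa using List.append_lt_append_of_not_prefix h hp v []

theorem IsLyndon.append {u v : List α} (hu : IsLyndon u) (hv : IsLyndon v) (h : u < v) :
    IsLyndon (u ++ v) := by
  refine ⟨by simp [hu.1], fun a b ha hb hab => ?_⟩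
  rcases List.append_eq_append_iff.mp hab with ⟨s, rfl, rfl⟩ | ⟨s, rfl, rfl⟩
  · rcases eq_or_ne s [] with rfl | hs
    · simpa using hu.append_lt hv h
    · exact (hu.append_lt hv h).trans (hv.2 s b hs hb rfl)
  · rcases eq_or_ne s [] with rfl | hs
    · simpa using hu.append_lt hv h
    · exact List.append_lt_append_of_lt_of_length_le (hu.2 a s ha hs rfl) (by simp) v v

theorem IsLyndon.append_lt_append_swap {u v : List α} (hu : IsLyndon u) (hv : IsLyndon v)
    (h : u < v) : u ++ v < v ++ u :=
  (hu.append_lt hv h).trans (List.lt_append_of_ne_nil hu.1)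

theorem IsLyndon.append_ne_append_swap {u v : List α} (hu : IsLyndon u) (hv : IsLyndon v)
    (h : u ≠ v) : u ++ v ≠ v ++ u := by
  rcases lt_or_gt_of_ne h with h | h
  · exact (hu.append_lt_append_swap hv h).ne
  · exact (hv.append_lt_append_swap hu h).ne.symm

/-- If `v` is at most every proper nonempty suffix of `u`, then it is at most every proper nonempty
suffix of `u ++ v`. -/
theorem IsLyndon.le_suffix_append {u v : List α} (hv : IsLyndon v)
    (hmin : ∀ a b, a ≠ [] → b ≠ [] → u = a ++ b → v ≤ b) {a b : List α} (ha : a ≠ [])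
    (hb : b ≠ []) (h : u ++ v = a ++ b) : v ≤ b := by
  rcases List.append_eq_append_iff.mp h with ⟨s, rfl, rfl⟩ | ⟨s, rfl, rfl⟩
  · rcases eq_or_ne s [] with rfl | hs
    · simp
    · exact (hv.2 s b hs hb rfl).le
  · rcases eq_or_ne s [] with rfl | hs
    · simp
    · exact (hmin a s ha hs rfl).trans (List.lt_append_of_ne_nil hv.1).le

end Lyndon

namespace FreeLieAlgebra

/-- The Lie subalgebra generated by the free generators is everything. -/
theorem mem_of_forall_of_mem {R X : Type*} [CommRing R]
    (S : LieSubalgebra R (FreeLieAlgebra R X)) (h : ∀ x, of R x ∈ S)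
    (z : FreeLieAlgebra R X) : z ∈ S := by
  have : S.incl.comp (lift R fun x => (⟨of R x, h x⟩ : S)) = LieHom.id := by
    ext x
    simp
  have hz := LieHom.congr_fun this z
  simp only [LieHom.comp_apply, LieHom.id_apply] at hz
  rw [← hz]
  exact Subtype.property _

variable {R : Type*} [CommRing R] {α : Type*} [LinearOrder α]

/-- `LyndonBracket w p` says that `p` is the standard bracketing of the Lyndon word `w`. -/
inductive LyndonBracket : List α → FreeLieAlgebra R α → Prop
  | letter (x : α) : LyndonBracket [x] (of R x)
  | bracket {u v : List α} {p q : FreeLieAlgebra R α} (hu : LyndonBracket u p)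
      (hv : LyndonBracket v q) (h : u < v)
      (hmin : ∀ a b, a ≠ [] → b ≠ [] → u = a ++ b → v ≤ b) : LyndonBracket (u ++ v) ⁅p, q⁆

namespace LyndonBracket

theorem isLyndon {w : List α} {p : FreeLieAlgebra R α} (h : LyndonBracket w p) : IsLyndon w := by
  induction h with
  | letter x => exact isLyndon_singleton x
  | bracket _ _ h _ ihu ihv => exact ihu.append ihv h

theorem unique {w : List α} {p q : FreeLieAlgebra R α} (hp : LyndonBracket w p)
    (hq : LyndonBracket w q) : p = q := by
  induction hp generalizing q with
  | letter x =>
    generalize hw : [x] = w at hq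
    cases hq with
    | letter y => simp at hw; rw [hw]
    | bracket hu hv _ _ =>
      exact absurd (congrArg List.length hw) (by
        have h1 := List.length_pos_of_ne_nil hu.isLyndon.1
        have h2 := List.length_pos_of_ne_nil hv.isLyndon.1
        simp
        omega)
  | @bracket u v _ _ hu hv h hmin ihu ihv =>
    generalize hw : u ++ v = w at hq
    cases hq with
    | letter y =>
      exact absurd (congrArg List.length hw) (by
        have h1 := List.length_pos_of_ne_nil hu.isLyndon.1
        have h2 := List.length_pos_of_ne_nil hv.isLyndon.1
        simp
        omega)
    | @bracket u' v' _ _ hu' hv' h' hmin' =>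
      have h1 := hv.isLyndon.le_suffix_append hmin hu'.isLyndon.1 hv'.isLyndon.1 hw
      have h2 := hv'.isLyndon.le_suffix_append hmin' hu.isLyndon.1 hv.isLyndon.1 hw.symm
      obtain rfl := le_antisymm h1 h2
      obtain rfl := List.append_cancel_right hw
      rw [ihu hu', ihv hv']

end LyndonBracket

variable (R) in
/-- The span of the Lyndon brackets of words of the same length as `w` which are at least `w`. -/
noncomputable def lyndonSpan (w : List α) : Submodule R (FreeLieAlgebra R α) :=
  Submodule.span R {r | ∃ w', LyndonBracket w' r ∧ w'.length = w.length ∧ w ≤ w'}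

theorem lyndonSpan_anti {w w' : List α} (hl : w'.length = w.length) (h : w ≤ w') :
    lyndonSpan R w' ≤ lyndonSpan R w :=
  Submodule.span_mono fun _ ⟨x, hx, hxl, hxw⟩ => ⟨x, hx, hxl.trans hl, h.trans hxw⟩

theorem lie_mem_of_mem_span {L : Type*} [LieRing L] [LieAlgebra R L] {s : Set L}
    {M : Submodule R L} {p m : L} (hm : m ∈ Submodule.span R s) (h : ∀ r ∈ s, ⁅p, r⁆ ∈ M) :
    ⁅p, m⁆ ∈ M := by
  induction hm using Submodule.span_induction with
  | mem r hr => exact h r hr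
  | zero => simp
  | add x y _ _ hx hy => rw [lie_add]; exact M.add_mem hx hy
  | smul a x _ hx => rw [lie_smul]; exact M.smul_mem a hx

/-- The bracket of two Lyndon brackets of words `u < v` is a combination of Lyndon brackets of words
at least `u ++ v`, of the same length. -/
theorem LyndonBracket.lie_mem_lyndonSpan [Finite α] {u v : List α} {p q : FreeLieAlgebra R α}
    (hu : LyndonBracket u p) (hv : LyndonBracket v q) (h : u < v) :
    ⁅p, q⁆ ∈ lyndonSpan R (u ++ v) := by
  suffices H : ∀ (N : ℕ) (w : {l : List α // l.length = N}) (k : ℕ) (u v : List α)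
      (p q : FreeLieAlgebra R α), LyndonBracket u p → LyndonBracket v q → u < v →
      u ++ v = w.1 → u.length = k → ⁅p, q⁆ ∈ lyndonSpan R w.1 from
    H _ ⟨u ++ v, rfl⟩ _ u v p q hu hv h rfl rfl
  clear hu hv h u v p q
  intro N
  induction N using Nat.strong_induction_on with
  | _ N ihN =>
  have : Finite {l : List α // l.length = N} := List.finite_length_eq α N
  intro w
  induction w using WellFoundedGT.induction with
  | _ w ihw =>
  intro k
  induction k using Nat.strong_induction_on with
  | _ k ihk =>
  intro u v p q hu hv huv hw hk
  have hwN := w.2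
  rw [← hw] at hwN
  have stay : ∀ {a b : List α}, a ≤ b → b.length = a.length → a = w.1 →
      lyndonSpan R b ≤ lyndonSpan R w.1 := fun hab hl ha => by
    rw [← ha]; exact lyndonSpan_anti hl hab
  cases hu with
  | letter x =>
    refine Submodule.subset_span ⟨_, LyndonBracket.bracket (LyndonBracket.letter x) hv huv ?_, ?_⟩
    · intro a b ha hb hab
      have h1 := List.length_pos_of_ne_nil ha
      have h2 := List.length_pos_of_ne_nil hb
      have := congrArg List.length hab
      simp at this
      omega
    · rw [hw]; simp
  | @bracket u' u'' p' p'' hu' hu'' hlt hmin =>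
    rcases le_or_gt v u'' with hle | hgt
    · refine Submodule.subset_span
        ⟨_, LyndonBracket.bracket (hu'.bracket hu'' hlt hmin) hv huv ?_, ?_⟩
      · intro a b ha hb hab
        exact hle.trans (hu''.isLyndon.le_suffix_append hmin ha hb hab)
      · rw [hw]; simp
    have h1 := List.length_pos_of_ne_nil hu'.isLyndon.1
    have h2 := List.length_pos_of_ne_nil hu''.isLyndon.1
    have h3 := List.length_pos_of_ne_nil hv.isLyndon.1
    simp only [List.length_append] at hwN hk
    have step : ∀ {x y : List α} {r s : FreeLieAlgebra R α}, LyndonBracket x r →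
        LyndonBracket y s → x < y → (x ++ y).length = N → w.1 < x ++ y →
        ⁅r, s⁆ ∈ lyndonSpan R w.1 := fun {x y r s} hx hy hxy hl hlt' =>
      stay (hlt'.le) (by rw [hl, w.2]) rfl
        (ihw ⟨x ++ y, hl⟩ hlt' _ x y r s hx hy hxy rfl rfl)
    rw [lie_lie]
    refine Submodule.sub_mem _ ?_ ?_
    · have hm := ihN (u'' ++ v).length (by simp; omega) ⟨_, rfl⟩ _ u'' v p'' q hu'' hv hgt rfl rfl
      refine lie_mem_of_mem_span hm ?_
      rintro r ⟨x, hx, hxl, hxle⟩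
      have hux : u' < x :=
        hlt.trans ((List.lt_append_of_ne_nil hv.isLyndon.1).trans_le hxle)
      have hl : (u' ++ x).length = N := by
        simp only [List.length_append] at hxl ⊢; omega
      rcases hxle.eq_or_lt with rfl | hxlt
      · exact ihk u'.length (by omega) u' _ p' r hu' hx hux (by rw [← hw]; simp) rfl
      · refine step hu' hx hux hl ?_
        rw [← hw, List.append_assoc]
        exact List.append_left_lt hxlt
    · have hm := ihN (u' ++ v).length (by simp; omega) ⟨_, rfl⟩ _ u' v p' q hu' hv
        (hlt.trans hgt) rfl rfl
      refine lie_mem_of_mem_span hm ?_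
      rintro r ⟨x, hx, hxl, hxle⟩
      simp only [List.length_append] at hxl
      rcases lt_trichotomy x u'' with hlt' | rfl | hgt'
      · rw [← lie_skew]
        refine Submodule.neg_mem _ (step hx hu'' hlt' (by simp; omega) ?_)
        have hsw : u' ++ u'' ++ v < u' ++ v ++ u'' := by
          rw [List.append_assoc, List.append_assoc]
          exact List.append_left_lt (hu''.isLyndon.append_lt_append_swap hv.isLyndon hgt)
        rw [← hw]
        rcases hxle.eq_or_lt with rfl | hxlt
        · exact hsw
        · exact hsw.trans
            (List.append_lt_append_of_lt_of_length_le hxlt (by simp; omega) _ _)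
      · rw [hu''.unique hx, lie_self]
        exact Submodule.zero_mem _
      · refine step hu'' hx hgt' (by simp; omega) ?_
        rw [← hw]
        exact List.append_lt_append_of_lt_of_length_le
          (hu'.isLyndon.append_lt hu''.isLyndon hlt) (by simp) _ _

/-- Lyndon brackets span the free Lie algebra on a finite alphabet. -/
theorem mem_span_lyndonBracket [Finite α] (z : FreeLieAlgebra R α) :
    z ∈ Submodule.span R {r : FreeLieAlgebra R α | ∃ w, LyndonBracket w r} := by
  set M := Submodule.span R {r : FreeLieAlgebra R α | ∃ w, LyndonBracket w r} with hM
  have key : ∀ {u v : List α} {p q : FreeLieAlgebra R α}, LyndonBracket u p →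
      LyndonBracket v q → u < v → ⁅p, q⁆ ∈ M := fun hu hv h =>
    Submodule.span_mono (by rintro _ ⟨x, hx, _⟩; exact ⟨x, hx⟩) (hu.lie_mem_lyndonSpan hv h)
  have closed : ∀ {x y}, x ∈ M → y ∈ M → ⁅x, y⁆ ∈ M := by
    intro x y hx hy
    refine lie_mem_of_mem_span hy ?_
    rintro q ⟨v, hv⟩
    rw [← lie_skew]
    refine Submodule.neg_mem _ (lie_mem_of_mem_span hx ?_)
    rintro p ⟨u, hu⟩
    rcases lt_trichotomy v u with h | rfl | h
    · exact key hv hu h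
    · rw [hu.unique hv, lie_self]
      exact M.zero_mem
    · rw [← lie_skew]
      exact M.neg_mem (key hu hv h)
  exact mem_of_forall_of_mem { M with lie_mem' := closed }
    (fun x => Submodule.subset_span ⟨_, LyndonBracket.letter x⟩) z

end FreeLieAlgebra

theorem Submonoid.eq_one_or_eq_mul_of_mem_closure_pair {M : Type*} [Monoid M] {u v z : M}
    (hz : z ∈ Submonoid.closure {u, v}) :
    z = 1 ∨ ∃ y ∈ Submonoid.closure {u, v}, z = u * y ∨ z = v * y := by
  induction hz using Submonoid.closure_induction_left with
  | one => exact Or.inl rfl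
  | mul_left x hx y hy _ =>
    refine Or.inr ⟨y, hy, ?_⟩
    rcases hx with rfl | rfl
    exacts [Or.inl rfl, Or.inr rfl]

namespace FreeMonoid

variable {α : Type*}

theorem mul_comm_of_mul_eq_mul {u v z z' : FreeMonoid α}
    (hz : z ∈ Submonoid.closure {u, v}) (hz' : z' ∈ Submonoid.closure {u, v})
    (h : u * z = v * z') : u * v = v * u := by
  induction hn : u.length + v.length using Nat.strong_induction_on generalizing u v z z' with
  | _ n ih =>
  have step : ∀ {u r z z' : FreeMonoid α}, u.length + r.length < n →
      z ∈ Submonoid.closure {u, u * r} → z' ∈ Submonoid.closure {u, u * r} → z = r * z' →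
      u * r = r * u := by
    intro u r z z' hlt hz hz' h
    have hle : Submonoid.closure {u, u * r} ≤ Submonoid.closure {u, r} := by
      rw [Submonoid.closure_le]
      have hu : u ∈ Submonoid.closure {u, r} := Submonoid.subset_closure (by simp)
      have hr : r ∈ Submonoid.closure {u, r} := Submonoid.subset_closure (by simp)
      rintro x (rfl | rfl)
      exacts [hu, mul_mem hu hr]
    rcases Submonoid.eq_one_or_eq_mul_of_mem_closure_pair hz with rfl | ⟨y, hy, rfl | rfl⟩
    · have : r = 1 := by
        have := congrArg length h
        simp only [length_one, length_mul] at this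
        exact length_eq_zero.mp (by omega)
      simp [this]
    · exact ih _ hlt (hle hy) (hle hz') h rfl
    · exact ih _ hlt (z := r * y) (mul_mem (Submonoid.subset_closure (by simp)) (hle hy))
        (hle hz') (by rw [← h, mul_assoc]) rfl
  rcases List.append_eq_append_iff.mp h with ⟨r, hr, hzr⟩ | ⟨r, hr, hzr⟩
  · change FreeMonoid α at r
    change v = u * r at hr
    change z = r * z' at hzr
    subst hr
    rcases eq_or_ne u 1 with rfl | hu
    · simp
    have : u.length ≠ 0 := fun h0 => hu (length_eq_zero.mp h0)
    rw [length_mul] at hn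
    have hc := step (by omega) hz hz' hzr
    rw [mul_assoc, ← hc]
  · change FreeMonoid α at r
    change u = v * r at hr
    change z' = r * z at hzr
    subst hr
    rcases eq_or_ne v 1 with rfl | hu
    · simp
    have : v.length ≠ 0 := fun h0 => hu (length_eq_zero.mp h0)
    rw [length_mul] at hn
    rw [Set.pair_comm] at hz hz'
    have hc := step (by omega) hz' hz hzr
    rw [mul_assoc, ← hc]

/-- Two words that do not commute freely generate a free monoid. -/
theorem lift_pair_injective {u v : FreeMonoid α} (h : u * v ≠ v * u) :
    Function.Injective (FreeMonoid.lift ![u, v]) := by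
  have hu : u ≠ 1 := by rintro rfl; simp at h
  have hv : v ≠ 1 := by rintro rfl; simp at h
  have hne : ∀ i, ![u, v] i ≠ 1 := by intro i; fin_cases i <;> simpa
  have hmem : ∀ m, FreeMonoid.lift ![u, v] m ∈ Submonoid.closure {u, v} := by
    intro m
    induction m using FreeMonoid.inductionOn' with
    | one => simp
    | of_mul i m ih =>
      rw [map_mul, lift_eval_of]
      refine mul_mem (Submonoid.subset_closure ?_) ih
      fin_cases i <;> simp
  intro m
  induction m using FreeMonoid.inductionOn' with
  | one =>
    intro m' hm
    cases m' using FreeMonoid.casesOn with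
    | one => rfl
    | of_mul i m' =>
      have := congrArg length hm
      simp only [map_one, map_mul, lift_eval_of, length_mul, length_one] at this
      exact absurd (length_eq_zero.mp (by omega)) (hne i)
  | of_mul i m ih =>
    intro m' hm
    cases m' using FreeMonoid.casesOn with
    | one =>
      have := congrArg length hm
      simp only [map_one, map_mul, lift_eval_of, length_mul, length_one] at this
      exact absurd (length_eq_zero.mp (by omega)) (hne i)
    | of_mul j m' =>
      rw [map_mul, map_mul, lift_eval_of, lift_eval_of] at hm
      rcases eq_or_ne i j with rfl | hij
      · rw [ih (mul_left_cancel hm)]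
      · refine absurd ?_ h
        fin_cases i <;> fin_cases j
        · exact absurd rfl hij
        · exact mul_comm_of_mul_eq_mul (hmem m) (hmem m') hm
        · exact mul_comm_of_mul_eq_mul (hmem m') (hmem m) hm.symm
        · exact absurd rfl hij

/-- The key by which words are compared: longer words are larger, and among words of the same
length the lexicographically smaller ones are larger. -/
def orderKey (w : FreeMonoid α) : ℕ ×ₗ (List α)ᵒᵈ :=
  toLex (w.length, OrderDual.toDual w.toList)

theorem orderKey_injective : Function.Injective (orderKey (α := α)) := by
  intro a b h
  have := congrArg Prod.snd (toLex.injective h)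
  exact FreeMonoid.toList.injective (OrderDual.toDual.injective this)

variable [LinearOrder α]

theorem orderKey_lt_iff {a b : FreeMonoid α} : orderKey a < orderKey b ↔
    a.length < b.length ∨ a.length = b.length ∧ b.toList < a.toList := by
  simp [orderKey, Prod.Lex.toLex_lt_toLex]

theorem orderKey_mul_lt_left {a b : FreeMonoid α} (h : orderKey a < orderKey b)
    (c : FreeMonoid α) : orderKey (c * a) < orderKey (c * b) := by
  rw [orderKey_lt_iff] at h ⊢
  simp only [length_mul, toList_mul]
  rcases h with h | ⟨h, h'⟩
  · left; omega
  · exact Or.inr ⟨by omega, List.append_left_lt h'⟩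

theorem orderKey_mul_lt_right {a b : FreeMonoid α} (h : orderKey a < orderKey b)
    (c : FreeMonoid α) : orderKey (a * c) < orderKey (b * c) := by
  rw [orderKey_lt_iff] at h ⊢
  simp only [length_mul, toList_mul]
  rcases h with h | ⟨h, h'⟩
  · left; omega
  · exact Or.inr ⟨by omega, List.append_lt_append_of_lt_of_length_le h' h.le c.toList c.toList⟩

theorem orderKey_mul_le {a b c d : FreeMonoid α} (h : orderKey a ≤ orderKey b)
    (h' : orderKey c ≤ orderKey d) : orderKey (a * c) ≤ orderKey (b * d) := by
  have h1 : orderKey (a * c) ≤ orderKey (b * c) := by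
    rcases h.eq_or_lt with h | h
    · rw [orderKey_injective h]
    · exact (orderKey_mul_lt_right h c).le
  refine h1.trans ?_
  rcases h'.eq_or_lt with h | h
  · rw [orderKey_injective h]
  · exact (orderKey_mul_lt_left h b).le

theorem eq_and_eq_of_orderKey_le {a b c d : FreeMonoid α} (h : orderKey a ≤ orderKey b)
    (h' : orderKey c ≤ orderKey d) (he : a * c = b * d) : a = b ∧ c = d := by
  have hab : a = b := by
    by_contra hne
    have h1 := orderKey_mul_lt_right (h.lt_of_ne (orderKey_injective.ne hne)) c
    have h2 := orderKey_mul_le (le_refl (orderKey b)) h'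
    exact absurd (h1.trans_le h2) (by rw [he]; exact lt_irrefl _)
  subst hab
  exact ⟨rfl, mul_left_cancel he⟩

end FreeMonoid

namespace MonoidAlgebra

open FreeMonoid

variable {R : Type*} [CommRing R] {α : Type*} [LinearOrder α]

/-- `w` is the leading word of the noncommutative polynomial `f`. -/
def IsLeadingWord (f : MonoidAlgebra R (FreeMonoid α)) (w : FreeMonoid α) : Prop :=
  f.coeff w ≠ 0 ∧ ∀ w', f.coeff w' ≠ 0 → orderKey w' ≤ orderKey w

namespace IsLeadingWord

variable {f g : MonoidAlgebra R (FreeMonoid α)} {u v : FreeMonoid α}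

theorem ne_zero (h : IsLeadingWord f u) : f ≠ 0 := by
  rintro rfl
  exact h.1 (by simp)

theorem coeff_eq_zero_of_lt (h : IsLeadingWord f u) (huv : orderKey u < orderKey v) :
    f.coeff v = 0 := by
  by_contra hne
  exact absurd (h.2 v hne) (not_le.mpr huv)

theorem single [Nontrivial R] (w : FreeMonoid α) :
    IsLeadingWord (MonoidAlgebra.single w (1 : R)) w := by
  classical
  refine ⟨by simp, fun w' hw' => ?_⟩
  rw [MonoidAlgebra.coeff_single, Finsupp.single_apply] at hw'
  split_ifs at hw' with h
  · rw [h]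
  · exact absurd rfl hw'

theorem mul [NoZeroDivisors R] (hf : IsLeadingWord f u) (hg : IsLeadingWord g v) :
    IsLeadingWord (f * g) (u * v) := by
  classical
  constructor
  · rw [MonoidAlgebra.coeff_mul_mul_of_uniqueMul]
    · exact mul_ne_zero hf.1 hg.1
    · intro a b ha hb hab
      exact eq_and_eq_of_orderKey_le (hf.2 a (Finsupp.mem_support_iff.mp ha))
        (hg.2 b (Finsupp.mem_support_iff.mp hb)) hab
  · intro w hw
    obtain ⟨a, ha, b, hb, rfl⟩ := Finset.mem_mul.mp
      (MonoidAlgebra.support_coeff_mul_subset f g (Finsupp.mem_support_iff.mpr hw))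
    exact orderKey_mul_le (hf.2 a (Finsupp.mem_support_iff.mp ha))
      (hg.2 b (Finsupp.mem_support_iff.mp hb))

theorem one [Nontrivial R] : IsLeadingWord (1 : MonoidAlgebra R (FreeMonoid α)) 1 :=
  single 1

theorem sub (hf : IsLeadingWord f u) (hg : IsLeadingWord g v) (h : orderKey v < orderKey u) :
    IsLeadingWord (f - g) u := by
  constructor
  · simpa [hg.coeff_eq_zero_of_lt h] using hf.1
  · intro w hw
    by_contra! hlt
    exact hw (by simp [hf.coeff_eq_zero_of_lt hlt, hg.coeff_eq_zero_of_lt (h.trans hlt)])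

/-- A nontrivial combination of polynomials with distinct leading words has the leading word of one
of them. -/
theorem exists_sum [NoZeroDivisors R] {ι : Type*} {F : ι → MonoidAlgebra R (FreeMonoid α)}
    {W : ι → FreeMonoid α} (hW : Function.Injective W) (hF : ∀ i, IsLeadingWord (F i) (W i))
    {c : ι →₀ R} (hc : c ≠ 0) :
    ∃ i, IsLeadingWord (c.sum fun i a => a • F i) (W i) := by
  obtain ⟨i, hi, hmax⟩ := c.support.exists_max_image (fun i => orderKey (W i))
    (Finsupp.support_nonempty_iff.mpr hc)
  have hcoeff : ∀ w, (c.sum fun i a => a • F i).coeff w =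
      ∑ j ∈ c.support, c j * (F j).coeff w := by
    intro w
    simp [Finsupp.sum, MonoidAlgebra.coeff_sum]
  refine ⟨i, ?_, fun w hw => ?_⟩
  · rw [hcoeff, Finset.sum_eq_single i]
    · exact mul_ne_zero (Finsupp.mem_support_iff.mp hi) (hF i).1
    · intro j hj hji
      rw [(hF j).coeff_eq_zero_of_lt
        ((hmax j hj).lt_of_ne (orderKey_injective.ne (hW.ne hji))), mul_zero]
    · exact fun h => absurd hi h
  · rw [hcoeff] at hw
    obtain ⟨j, hj, hjw⟩ := Finset.exists_ne_zero_of_sum_ne_zero hw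
    exact ((hF j).2 w (right_ne_zero_of_mul hjw)).trans (hmax j hj)

end IsLeadingWord

end MonoidAlgebra

namespace FreeLieAlgebra

section Associative

attribute [local instance] LieRing.ofAssociativeRing

open MonoidAlgebra

variable {R : Type*} [CommRing R] {α : Type*}

variable (R α) in
/-- The canonical map from the free Lie algebra to the free associative algebra, realised as the
algebra of the free monoid. -/
noncomputable def toMonoidAlgebra :
    FreeLieAlgebra R α →ₗ⁅R⁆ MonoidAlgebra R (FreeMonoid α) :=
  lift R fun x => MonoidAlgebra.single (FreeMonoid.of x) 1

@[simp]
theorem toMonoidAlgebra_of (x : α) :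
    toMonoidAlgebra R α (of R x) = MonoidAlgebra.single (FreeMonoid.of x) 1 :=
  lift_of_apply _ x

theorem toMonoidAlgebra_lie (p q : FreeLieAlgebra R α) :
    toMonoidAlgebra R α ⁅p, q⁆ = toMonoidAlgebra R α p * toMonoidAlgebra R α q -
      toMonoidAlgebra R α q * toMonoidAlgebra R α p := by
  rw [LieHom.map_lie, LieRing.of_associative_ring_bracket]

theorem toMonoidAlgebra_lift {β : Type*} (f : β → FreeLieAlgebra R α) (z : FreeLieAlgebra R β) :
    toMonoidAlgebra R α (lift R f z) =
      MonoidAlgebra.lift R _ _ (FreeMonoid.lift fun i => toMonoidAlgebra R α (f i))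
        (toMonoidAlgebra R β z) := by
  have : (toMonoidAlgebra R α).comp (lift R f) =
      (MonoidAlgebra.lift R _ _ (FreeMonoid.lift fun i => toMonoidAlgebra R α (f i))).toLieHom.comp
        (toMonoidAlgebra R β) := by
    ext1 x
    simp
  exact LieHom.congr_fun this z

variable [LinearOrder α] [IsDomain R]

theorem LyndonBracket.isLeadingWord {w : List α} {p : FreeLieAlgebra R α}
    (h : LyndonBracket w p) : IsLeadingWord (toMonoidAlgebra R α p) (FreeMonoid.ofList w) := by
  induction h with
  | letter x =>
    rw [toMonoidAlgebra_of]
    exact IsLeadingWord.single _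
  | bracket hu hv h _ ihu ihv =>
    rw [toMonoidAlgebra_lie, FreeMonoid.ofList_append]
    refine (ihu.mul ihv).sub (ihv.mul ihu) (FreeMonoid.orderKey_lt_iff.mpr (Or.inr ⟨?_, ?_⟩))
    · simp only [FreeMonoid.length_mul, add_comm]
    · simpa using hu.isLyndon.append_lt_append_swap hv.isLyndon h

/-- Every nonzero element of a free Lie algebra has a leading word, which is a Lyndon word. -/
theorem exists_isLeadingWord [Finite α] {z : FreeLieAlgebra R α} (hz : z ≠ 0) :
    ∃ w : List α, IsLyndon w ∧
      IsLeadingWord (toMonoidAlgebra R α z) (FreeMonoid.ofList w) := by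
  let ι := {w : List α // ∃ p : FreeLieAlgebra R α, LyndonBracket w p}
  let P : ι → FreeLieAlgebra R α := fun i => i.property.choose
  have hP : ∀ i : ι, LyndonBracket i.1 (P i) := fun i => i.property.choose_spec
  have hspan : z ∈ Submodule.span R (Set.range P) :=
    Submodule.span_mono (by rintro p ⟨w, hw⟩; exact ⟨⟨w, p, hw⟩, (hP _).unique hw⟩)
      (mem_span_lyndonBracket z)
  obtain ⟨c, rfl⟩ := Finsupp.mem_span_range_iff_exists_finsupp.mp hspan
  have hc : c ≠ 0 := by rintro rfl; simp at hz
  obtain ⟨i, hi⟩ := IsLeadingWord.exists_sum (W := fun i : ι => FreeMonoid.ofList i.1)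
    (fun i j h => Subtype.ext (FreeMonoid.ofList.injective h))
    (fun i => (hP i).isLeadingWord) hc
  refine ⟨i.1, (hP i).isLyndon, ?_⟩
  convert hi
  simp only [Finsupp.sum, map_sum, map_smul]

/-- The free Lie algebra over an integral domain embeds in the free associative algebra. -/
theorem toMonoidAlgebra_injective [Finite α] : Function.Injective (toMonoidAlgebra R α) := by
  refine (injective_iff_map_eq_zero _).mpr fun z hz => ?_
  by_contra hne
  obtain ⟨w, _, hw⟩ := exists_isLeadingWord hne
  exact hw.ne_zero hz

theorem smul_eq_zero_iff [Finite α] {a : R} {z : FreeLieAlgebra R α} :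
    a • z = 0 ↔ a = 0 ∨ z = 0 := by
  refine ⟨fun h => ?_, by rintro (rfl | rfl) <;> simp⟩
  have h' := congrArg (toMonoidAlgebra R α) h
  rw [map_smul, map_zero, smul_eq_zero] at h'
  exact h'.imp_right fun h0 => toMonoidAlgebra_injective (h0.trans (map_zero _).symm)

/-- Two elements with distinct Lyndon leading words are Lie-independent. -/
theorem lift_injective_of_isLeadingWord_ne {f g : FreeLieAlgebra R α} {u v : List α}
    (hu : IsLyndon u) (hv : IsLyndon v) (huv : u ≠ v)
    (hf : IsLeadingWord (toMonoidAlgebra R α f) (FreeMonoid.ofList u))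
    (hg : IsLeadingWord (toMonoidAlgebra R α g) (FreeMonoid.ofList v)) :
    Function.Injective (lift R ![f, g]) := by
  refine (injective_iff_map_eq_zero _).mpr fun z hz => ?_
  have hW : Function.Injective (FreeMonoid.lift ![FreeMonoid.ofList u, FreeMonoid.ofList v]) :=
    FreeMonoid.lift_pair_injective fun h => hu.append_ne_append_swap hv huv
      (FreeMonoid.ofList.injective (by simpa using h))
  have hF : ∀ m, IsLeadingWord (FreeMonoid.lift (fun i => toMonoidAlgebra R α (![f, g] i)) m)
      (FreeMonoid.lift ![FreeMonoid.ofList u, FreeMonoid.ofList v] m) := by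
    intro m
    induction m using FreeMonoid.inductionOn' with
    | one => simpa using IsLeadingWord.one
    | of_mul i m ih =>
      rw [map_mul, map_mul, FreeMonoid.lift_eval_of, FreeMonoid.lift_eval_of]
      refine IsLeadingWord.mul ?_ ih
      fin_cases i
      exacts [hf, hg]
  have hsum := toMonoidAlgebra_lift ![f, g] z
  rw [hz, map_zero, MonoidAlgebra.lift_apply] at hsum
  by_contra hne
  have hc : (toMonoidAlgebra R (Fin 2) z).coeff ≠ 0 := by
    intro h0
    obtain ⟨w, _, hw⟩ := exists_isLeadingWord hne
    exact hw.1 (by rw [h0]; rfl)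
  obtain ⟨i, hi⟩ := IsLeadingWord.exists_sum hW hF hc
  exact hi.ne_zero hsum.symm

end Associative

/-- Lie-independence of `b • f - a • g` and `g`, with `b ≠ 0`, implies that of `f` and `g`. -/
theorem lift_injective_of_lift_smul_sub_injective {R : Type*} [CommRing R] [IsDomain R]
    {α : Type*} {f g : FreeLieAlgebra R α} {a b : R}
    (hb : b ≠ 0) (h : Function.Injective (lift R ![b • f - a • g, g])) :
    Function.Injective (lift R ![f, g]) := by
  set φ : FreeLieAlgebra R (Fin 2) →ₗ⁅R⁆ FreeLieAlgebra R (Fin 2) :=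
    lift R ![b • of R 0 - a • of R 1, of R 1] with hφ
  have hcomp : ∀ z, lift R ![f, g] (φ z) = lift R ![b • f - a • g, g] z := by
    have : (lift R ![f, g]).comp φ = lift R ![b • f - a • g, g] := by
      ext1 i
      fin_cases i <;> simp [hφ]
    exact LieHom.congr_fun this
  let S : LieSubalgebra R (FreeLieAlgebra R (Fin 2)) :=
    { carrier := {z | ∃ (N : ℕ) (y : _), b ^ N • z = φ y}
      zero_mem' := ⟨0, 0, by simp⟩
      add_mem' := by
        rintro x y ⟨N, x', hx⟩ ⟨M, y', hy⟩
        refine ⟨N + M, b ^ M • x' + b ^ N • y', ?_⟩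
        rw [map_add, map_smul, map_smul, ← hx, ← hy, smul_smul, smul_smul, ← pow_add, ← pow_add,
          smul_add, add_comm M N]
      smul_mem' := by
        rintro c x ⟨N, x', hx⟩
        exact ⟨N, c • x', by rw [map_smul, ← hx, smul_comm]⟩
      lie_mem' := by
        rintro x y ⟨N, x', hx⟩ ⟨M, y', hy⟩
        refine ⟨N + M, ⁅x', y'⁆, ?_⟩
        rw [LieHom.map_lie, ← hx, ← hy, smul_lie, lie_smul, smul_smul, ← pow_add] }
  refine (injective_iff_map_eq_zero _).mpr fun z hz => ?_
  have hzS : z ∈ S := by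
    refine mem_of_forall_of_mem S (fun i => ?_) z
    fin_cases i
    · refine ⟨1, of R 0 + a • of R 1, ?_⟩
      simp [hφ]
    · exact ⟨0, of R 1, by simp [hφ]⟩
  obtain ⟨N, y, hy⟩ := hzS
  have hy0 : y = 0 := by
    refine (injective_iff_map_eq_zero _).mp h y ?_
    rw [← hcomp, ← hy, map_smul, hz, smul_zero]
  rw [hy0, map_zero] at hy
  exact (smul_eq_zero_iff.mp hy).resolve_left (pow_ne_zero N hb)

/-- Two linearly independent elements of a free Lie algebra over a domain are Lie-independent. -/
theorem lift_injective_of_linearIndependent {R : Type*} [CommRing R] [IsDomain R]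
    {α : Type*} [LinearOrder α] [Finite α] {f g : FreeLieAlgebra R α}
    (h : LinearIndependent R ![f, g]) : Function.Injective (lift R ![f, g]) := by
  have hf : f ≠ 0 := h.ne_zero 0
  have hg : g ≠ 0 := h.ne_zero 1
  obtain ⟨u, hu, hfu⟩ := exists_isLeadingWord hf
  obtain ⟨v, hv, hgv⟩ := exists_isLeadingWord hg
  rcases eq_or_ne u v with rfl | huv
  · set a := (toMonoidAlgebra R α f).coeff (FreeMonoid.ofList u) with ha
    set b := (toMonoidAlgebra R α g).coeff (FreeMonoid.ofList u) with hb
    refine lift_injective_of_lift_smul_sub_injective (a := a) (b := b) hgv.1 ?_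
    have hne : b • f - a • g ≠ 0 := by
      intro h0
      refine hgv.1 (LinearIndependent.pair_iff.mp h b (-a) ?_).1
      rw [neg_smul, ← sub_eq_add_neg, h0]
    obtain ⟨w, hw, hlead⟩ := exists_isLeadingWord hne
    refine lift_injective_of_isLeadingWord_ne hw hu ?_ hlead hgv
    rintro rfl
    refine hlead.1 ?_
    simp [← ha, ← hb, mul_comm]
  · exact lift_injective_of_isLeadingWord_ne hu hv huv hfu hgv

/-- The free generators of a free Lie algebra are linearly independent. -/
theorem linearIndependent_of {R X : Type*} [CommRing R] :
    LinearIndependent R (of R : X → FreeLieAlgebra R X) := by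
  let _ : LieRing (X →₀ R) := { (inferInstance : AddCommGroup (X →₀ R)) with
    bracket := fun _ _ => 0
    add_lie := by simp
    lie_add := by simp
    lie_self := by simp
    leibniz_lie := by simp }
  let _ : LieAlgebra R (X →₀ R) := { (inferInstance : Module R (X →₀ R)) with
    lie_smul := by intros; exact (smul_zero _).symm }
  let F : FreeLieAlgebra R X →ₗ⁅R⁆ (X →₀ R) := lift R fun x => Finsupp.single x 1
  refine LinearIndependent.of_comp (F : FreeLieAlgebra R X →ₗ[R] (X →₀ R)) ?_
  have hF : ⇑(F : FreeLieAlgebra R X →ₗ[R] (X →₀ R)) ∘ of R = fun x => Finsupp.single x 1 :=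
    of_comp_lift fun x => Finsupp.single x (1 : R)
  rw [hF]
  exact Finsupp.linearIndependent_single_one R X

end FreeLieAlgebra

/-- Two elements `f₁, f₂` of the free Lie algebra `L_Φ⟨x_1,…,x_n⟩` over an integral
domain `Φ` are Lie-dependent (they do not freely generate a free Lie subalgebra of
rank 2, i.e. the canonical homomorphism from the free Lie algebra on two generators
sending the generators to `f₁, f₂` is not injective) if and only if `f₁, f₂` are
linearly dependent over `Φ`. -/
theorem lie_dependent_iff_linear_dependent
    (Φ : Type*) [CommRing Φ] [IsDomain Φ] (n : ℕ)
    (f₁ f₂ : FreeLieAlgebra Φ (Fin n)) :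
    (¬ Function.Injective ⇑(FreeLieAlgebra.lift Φ ![f₁, f₂])) ↔
      ¬ LinearIndependent Φ ![f₁, f₂] := by
  refine not_congr ⟨fun h => ?_, FreeLieAlgebra.lift_injective_of_linearIndependent⟩
  refine LinearIndependent.pair_iff.mpr fun s t hst => ?_
  have h0 : s • FreeLieAlgebra.of Φ (0 : Fin 2) + t • FreeLieAlgebra.of Φ 1 = 0 :=
    h (by simpa using hst)
  have hli := Fintype.linearIndependent_iff.mp
    (FreeLieAlgebra.linearIndependent_of (R := Φ) (X := Fin 2)) ![s, t] (by simpa using h0)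
  exact ⟨hli 0, hli 1⟩
end

section
/- Let Φ be a Euclidean ring and let z ∈ Φ be a nonzero non-unit. The endomorphism δ of L_3(Φ) = L_Φ⟨x_1,x_2,x_3⟩ defined by δ(x_1) = x_1 + [z x_1 − [x_2,x_3], x_3], δ(x_2) = x_2 + z(z x_1 − [x_2,x_3]), δ(x_3) = x_3 is an automorphism; in particular, its images b_1, b_2, b_3 generate L_3(Φ), since z b_1 − [b_2,b_3] = z x_1 − [x_2,x_3], b_2 − z(z b_1 − [b_2,b_3]) = x_2, and b_1 − [z b_1 − [b_2,b_3], b_3] = x_1. -/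
/-- A Euclidean ring structure on an integral domain `Φ` (which is not a field):
a norm `|·| : Φ\{0} → ℕ` with `|ab| ≥ |a|`, with equality iff `b` is a unit, and
division with remainder. -/
structure EuclideanRingStruct (Φ : Type*) [CommRing Φ] where
  nrm : Φ → ℕ
  nrm_le_nrm_mul : ∀ a b : Φ, a ≠ 0 → b ≠ 0 → nrm a ≤ nrm (a * b)
  nrm_mul_eq_iff : ∀ a b : Φ, a ≠ 0 → b ≠ 0 → (nrm (a * b) = nrm a ↔ IsUnit b)
  division : ∀ a b : Φ, b ≠ 0 → ∃ q r : Φ, a = b * q + r ∧ (r = 0 ∨ nrm r < nrm b)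
  not_field : ∃ a : Φ, a ≠ 0 ∧ ¬IsUnit a

theorem FreeLieAlgebra.eq_top_of_of_mem {R X : Type*} [CommRing R]
    (S : LieSubalgebra R (FreeLieAlgebra R X)) (h : ∀ x, FreeLieAlgebra.of R x ∈ S) : S = ⊤ := by
  have key : S.incl.comp (FreeLieAlgebra.lift R fun x => (⟨FreeLieAlgebra.of R x, h x⟩ : S)) =
      LieHom.id := by
    ext x
    simp
  refine eq_top_iff.2 fun y _ => ?_
  rw [← LieHom.id_apply (R := R) y, ← key]
  exact Subtype.property _

theorem FreeLieAlgebra.lift_bijective_of_inverse {R X : Type*} [CommRing R]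
    (f g : X → FreeLieAlgebra R X)
    (hfg : ∀ x, FreeLieAlgebra.lift R f (g x) = FreeLieAlgebra.of R x)
    (hgf : ∀ x, FreeLieAlgebra.lift R g (f x) = FreeLieAlgebra.of R x) :
    Function.Bijective (FreeLieAlgebra.lift R f) := by
  have h₁ : (FreeLieAlgebra.lift R f).comp (FreeLieAlgebra.lift R g) = LieHom.id := by
    ext x
    simp [hfg]
  have h₂ : (FreeLieAlgebra.lift R g).comp (FreeLieAlgebra.lift R f) = LieHom.id := by
    ext x
    simp [hgf]
  exact Function.bijective_iff_has_inverse.2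
    ⟨FreeLieAlgebra.lift R g, LieHom.congr_fun h₂, LieHom.congr_fun h₁⟩

/-- The element `z a - [b, c]` is unchanged when `(a, b)` is shifted by `([w, c], z w)`. -/
theorem smul_add_lie_sub_lie_add_smul {R L : Type*} [CommRing R] [LieRing L] [LieAlgebra R L]
    (z : R) (a b c w : L) : z • (a + ⁅w, c⁆) - ⁅b + z • w, c⁆ = z • a - ⁅b, c⁆ := by
  rw [smul_add, add_lie, smul_lie]
  abel

theorem smul_sub_lie_sub_lie_sub_smul {R L : Type*} [CommRing R] [LieRing L] [LieAlgebra R L]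
    (z : R) (a b c w : L) : z • (a - ⁅w, c⁆) - ⁅b - z • w, c⁆ = z • a - ⁅b, c⁆ := by
  rw [smul_sub, sub_lie, smul_lie]
  abel

/-- Let `Φ` be a Euclidean ring and `z ∈ Φ` a nonzero non-unit.  The endomorphism
`δ` of `L₃(Φ) = L_Φ⟨x₁,x₂,x₃⟩` given by `δ(x₁) = x₁ + [z x₁ − [x₂,x₃], x₃]`,
`δ(x₂) = x₂ + z(z x₁ − [x₂,x₃])`, `δ(x₃) = x₃` is an automorphism; in particular
its images `b₁, b₂, b₃` generate `L₃(Φ)`. -/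
theorem anick_endomorphism_is_automorphism
    (Φ : Type*) [CommRing Φ] [IsDomain Φ] (E : EuclideanRingStruct Φ)
    (z : Φ) (hz : z ≠ 0) (hzu : ¬ IsUnit z) :
    Function.Bijective
      ⇑(FreeLieAlgebra.lift Φ
        ![FreeLieAlgebra.of Φ (0 : Fin 3) +
            ⁅z • FreeLieAlgebra.of Φ (0 : Fin 3) -
              ⁅FreeLieAlgebra.of Φ (1 : Fin 3), FreeLieAlgebra.of Φ (2 : Fin 3)⁆,
              FreeLieAlgebra.of Φ (2 : Fin 3)⁆,
          FreeLieAlgebra.of Φ (1 : Fin 3) +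
            z • (z • FreeLieAlgebra.of Φ (0 : Fin 3) -
              ⁅FreeLieAlgebra.of Φ (1 : Fin 3), FreeLieAlgebra.of Φ (2 : Fin 3)⁆),
          FreeLieAlgebra.of Φ (2 : Fin 3)]) ∧
    LieSubalgebra.lieSpan Φ (FreeLieAlgebra Φ (Fin 3))
      {FreeLieAlgebra.of Φ (0 : Fin 3) +
          ⁅z • FreeLieAlgebra.of Φ (0 : Fin 3) -
            ⁅FreeLieAlgebra.of Φ (1 : Fin 3), FreeLieAlgebra.of Φ (2 : Fin 3)⁆,
            FreeLieAlgebra.of Φ (2 : Fin 3)⁆,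
        FreeLieAlgebra.of Φ (1 : Fin 3) +
          z • (z • FreeLieAlgebra.of Φ (0 : Fin 3) -
            ⁅FreeLieAlgebra.of Φ (1 : Fin 3), FreeLieAlgebra.of Φ (2 : Fin 3)⁆),
        FreeLieAlgebra.of Φ (2 : Fin 3)} = ⊤ := by
  constructor
  · refine FreeLieAlgebra.lift_bijective_of_inverse _
      ![FreeLieAlgebra.of Φ (0 : Fin 3) -
          ⁅z • FreeLieAlgebra.of Φ (0 : Fin 3) -
            ⁅FreeLieAlgebra.of Φ (1 : Fin 3), FreeLieAlgebra.of Φ (2 : Fin 3)⁆,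
            FreeLieAlgebra.of Φ (2 : Fin 3)⁆,
        FreeLieAlgebra.of Φ (1 : Fin 3) -
          z • (z • FreeLieAlgebra.of Φ (0 : Fin 3) -
            ⁅FreeLieAlgebra.of Φ (1 : Fin 3), FreeLieAlgebra.of Φ (2 : Fin 3)⁆),
        FreeLieAlgebra.of Φ (2 : Fin 3)] ?_ ?_ <;> intro i <;> fin_cases i <;>
      simp [-smul_add, -add_lie, -sub_lie, -lie_add, -lie_sub,
        smul_add_lie_sub_lie_add_smul, smul_sub_lie_sub_lie_sub_smul]
  · generalize hS : LieSubalgebra.lieSpan Φ (FreeLieAlgebra Φ (Fin 3)) _ = S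
    have hsub := hS ▸ LieSubalgebra.subset_lieSpan
    simp only [Set.insert_subset_iff, Set.singleton_subset_iff, SetLike.mem_coe] at hsub
    obtain ⟨h₁, h₂, h₃⟩ := hsub
    have hw := sub_mem (S.smul_mem z h₁) (S.lie_mem h₂ h₃)
    rw [smul_add_lie_sub_lie_add_smul] at hw
    refine FreeLieAlgebra.eq_top_of_of_mem S fun i => ?_
    fin_cases i
    · exact (add_mem_cancel_right (S.lie_mem hw h₃)).1 h₁
    · exact (add_mem_cancel_right (S.smul_mem z hw)).1 h₂
    · exact h₃
end
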